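/- arXiv:quant-ph/0210141 — 2 statements merged into one kernel-verified Lean document; each statement's English description precedes it below -/
import Mathlib

section
/- Let P, Q, m, n be positive integers with Q ≥ 2P², gcd(n, P) = 1, and m/Q ≤ n/P < (m+1)/Q. Then n/P is one of the convergents of the continued fraction expansion of the rational number m/Q. -/
/-- In the period-finding algorithm: if `Q ≥ 2P²`, `gcd(n, P) = 1`, and the measured
eigenvalue `m/Q` satisfies `m/Q ≤ n/P < (m+1)/Q`, then `n/P` is a convergent of the
continued fraction expansion of `m/Q`. -/
theorem continuous_shor_eigenvalue_convergent (P Q m n : ℕ) (hP : 0 < P) (hQ : 0 < Q)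
    (hm : 0 < m) (hn : 0 < n) (hQP : Q ≥ 2 * P ^ 2) (hcop : Nat.gcd n P = 1)
    (h1 : (m : ℚ) / Q ≤ (n : ℚ) / P) (h2 : (n : ℚ) / P < ((m : ℚ) + 1) / Q) :
    ∃ k : ℕ, ((n : ℚ) / (P : ℚ)) = Real.convergent (((m : ℚ) / (Q : ℚ) : ℚ) : ℝ) k := by
  have hden : ((n : ℚ) / P).den = P := by
    have := Rat.den_div_eq_of_coprime (a := (n : ℤ)) (b := (P : ℤ))
      (by exact_mod_cast hP) (by simpa [Nat.Coprime] using hcop)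
    simpa using this
  apply Real.exists_rat_eq_convergent
  rw [hden, ← Rat.cast_sub, ← Rat.cast_abs]
  have hQ' : (0 : ℚ) < Q := by exact_mod_cast hQ
  have hP' : (0 : ℚ) < P := by exact_mod_cast hP
  have hQP' : (2 : ℚ) * (P : ℚ) ^ 2 ≤ Q := by exact_mod_cast hQP
  have key : |(m : ℚ) / Q - (n : ℚ) / P| < 1 / (2 * (P : ℚ) ^ 2) := by
    rw [abs_of_nonpos (by linarith)]
    rw [add_div] at h2
    have : (1 : ℚ) / Q ≤ 1 / (2 * (P : ℚ) ^ 2) :=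
      one_div_le_one_div_of_le (by positivity) hQP'
    linarith
  simpa only [Rat.cast_div, Rat.cast_mul, Rat.cast_pow, Rat.cast_one, Rat.cast_ofNat,
    Rat.cast_natCast] using (Rat.cast_lt (K := ℝ)).mpr key
end

section
/- Let a be a fixed positive integer. For a positive integer N, let T_a(N) denote the number of ordered pairs (n₁, n₂) of integers with 1 ≤ n₁, n₂ ≤ N such that gcd(n₁, n₂) = 1, gcd(a, n₁) = 1, and gcd(a, n₂) = 1, and let D_a(N) denote the number of ordered pairs (n₁, n₂) with 1 ≤ n₁, n₂ ≤ N, gcd(a, n₁) = 1, and gcd(a, n₂) = 1. Then liminf_{N → ∞} T_a(N)/D_a(N) ≥ 6/π². -/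
open Filter Real

/-- The number of `n ∈ {1, …, N}` coprime to `a`. -/
def coprimeCount (a N : ℕ) : ℕ := ((Finset.Icc 1 N).filter a.Coprime).card

lemma coprimeCount_le (a N : ℕ) : coprimeCount a N ≤ N := by
  simpa [coprimeCount] using Finset.card_filter_le (Finset.Icc 1 N) a.Coprime

lemma coprimeCount_add_self (a N : ℕ) :
    coprimeCount a (N + a) = coprimeCount a N + a.totient := by
  have hIcc (M : ℕ) : Finset.Icc 1 M = Finset.Ico 1 (M + 1) := by ext; simp
  rw [← Nat.filter_coprime_Ico_eq_totient a (N + 1), coprimeCount, coprimeCount, hIcc, hIcc,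
    ← Finset.card_union_of_disjoint, ← Finset.filter_union, add_right_comm N a 1,
    Finset.Ico_union_Ico_eq_Ico (by omega) (by omega)]
  exact Finset.disjoint_filter_filter (Finset.Ico_disjoint_Ico_consecutive _ _ _)

lemma abs_coprimeCount_sub_le {a : ℕ} (ha : 0 < a) (N : ℕ) :
    |(coprimeCount a N : ℝ) - a.totient / a * N| ≤ a := by
  have ha' : (0 : ℝ) < a := by exact_mod_cast ha
  have hper : Function.Periodic (fun N : ℕ ↦ (coprimeCount a N : ℝ) - a.totient / a * N) a := by
    intro N
    simp only [coprimeCount_add_self]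
    push_cast
    field_simp
    ring
  have hmod := hper.map_mod_nat N
  rw [← hmod]
  have hr : ((N % a : ℕ) : ℝ) ≤ a := by exact_mod_cast (Nat.mod_lt N ha).le
  have hc : (coprimeCount a (N % a) : ℝ) ≤ (N % a : ℕ) := by exact_mod_cast coprimeCount_le _ _
  have ht : (a.totient / a : ℝ) ≤ 1 := by
    rw [div_le_one ha']
    exact_mod_cast Nat.totient_le a
  have ht0 : (0 : ℝ) ≤ a.totient / a * (N % a : ℕ) := by positivity
  have := mul_le_mul_of_nonneg_right ht (Nat.cast_nonneg (α := ℝ) (N % a))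
  have hc0 := Nat.cast_nonneg (α := ℝ) (coprimeCount a (N % a))
  rw [abs_le]
  constructor <;> linarith

lemma tendsto_coprimeCount_div {a : ℕ} (ha : 0 < a) {d : ℕ} (hd : 0 < d) :
    Tendsto (fun N : ℕ ↦ (coprimeCount a (N / d) : ℝ) / N) atTop
      (nhds (a.totient / a / d)) := by
  rw [tendsto_iff_norm_sub_tendsto_zero]
  refine squeeze_zero' (.of_forall fun _ ↦ norm_nonneg _) ?_
    (tendsto_const_div_atTop_nhds_zero_nat ((a : ℝ) + 1))
  filter_upwards [eventually_gt_atTop 0] with N hN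
  have hN' : (0 : ℝ) < N := by exact_mod_cast hN
  have ha' : (0 : ℝ) < a := by exact_mod_cast ha
  have hd' : (0 : ℝ) < d := by exact_mod_cast hd
  have h1 := abs_coprimeCount_sub_le ha (N / d)
  have ht : (a.totient / a : ℝ) ≤ 1 := by
    rw [div_le_one ha']
    exact_mod_cast Nat.totient_le a
  have ht0 : (0 : ℝ) ≤ a.totient / a := by positivity
  have hfloor : |((N / d : ℕ) : ℝ) - N / d| ≤ 1 := by
    rw [← Nat.floor_div_eq_div (K := ℝ), abs_sub_comm]
    have := Nat.floor_le (show (0 : ℝ) ≤ (N : ℝ) / d by positivity)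
    have := Nat.lt_floor_add_one ((N : ℝ) / d)
    rw [abs_le]
    constructor <;> linarith
  have h2 : |(a.totient / a : ℝ) * (((N / d : ℕ) : ℝ) - N / d)| ≤ 1 := by
    rw [abs_mul, abs_of_nonneg ht0]
    exact mul_le_one₀ ht (abs_nonneg _) hfloor
  rw [Real.norm_eq_abs, show (coprimeCount a (N / d) : ℝ) / N - a.totient / a / d =
    ((coprimeCount a (N / d) - a.totient / a * (N / d : ℕ)) +
      a.totient / a * (((N / d : ℕ) : ℝ) - N / d)) / N by field_simp; ring,
    abs_div, abs_of_pos hN']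
  gcongr
  exact (abs_add_le _ _).trans (add_le_add h1 h2)

lemma card_filter_coprime_dvd (a N d : ℕ) (hd : 0 < d) :
    ((Finset.Icc 1 N).filter (fun n ↦ a.Coprime n ∧ d ∣ n)).card =
      if a.Coprime d then coprimeCount a (N / d) else 0 := by
  split_ifs with h
  · rw [coprimeCount, ← Finset.card_image_of_injective
      ((Finset.Icc 1 (N / d)).filter a.Coprime) (mul_right_injective₀ hd.ne')]
    congr 1
    ext n
    simp only [Finset.mem_filter, Finset.mem_Icc, Finset.mem_image]
    constructor
    · rintro ⟨⟨h1, h2⟩, h3, m, rfl⟩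
      exact ⟨m, ⟨⟨Nat.pos_of_mul_pos_left h1, (Nat.le_div_iff_mul_le hd).2 (by linarith)⟩,
        h3.coprime_dvd_right (dvd_mul_left _ _)⟩, rfl⟩
    · rintro ⟨m, ⟨⟨h1, h2⟩, h3⟩, rfl⟩
      exact ⟨⟨Nat.mul_pos hd h1, by linarith [(Nat.le_div_iff_mul_le hd).1 h2]⟩,
        h.mul_right h3, dvd_mul_right _ _⟩
  · rw [Finset.card_eq_zero, Finset.filter_eq_empty_iff]
    exact fun n _ hn ↦ h (hn.1.coprime_dvd_right hn.2)

lemma sum_divisors_moebius_eq_ite {n : ℕ} :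
    ∑ d ∈ n.divisors, ArithmeticFunction.moebius d = if n = 1 then 1 else 0 := by
  rw [← ArithmeticFunction.coe_mul_zeta_apply, ArithmeticFunction.moebius_mul_coe_zeta,
    ArithmeticFunction.one_apply]

lemma card_coprime_pairs (a N : ℕ) :
    (((Finset.Icc 1 N ×ˢ Finset.Icc 1 N).filter fun p : ℕ × ℕ ↦
        p.1.Coprime p.2 ∧ a.Coprime p.1 ∧ a.Coprime p.2).card : ℤ) =
      ∑ d ∈ Finset.Icc 1 N, ArithmeticFunction.moebius d *
        (if a.Coprime d then (coprimeCount a (N / d) : ℤ) else 0) ^ 2 := by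
  set P := (Finset.Icc 1 N ×ˢ Finset.Icc 1 N).filter fun p : ℕ × ℕ ↦
    a.Coprime p.1 ∧ a.Coprime p.2 with hP
  have hpair (p : ℕ × ℕ) (hp : p ∈ P) : (if p.1.Coprime p.2 then (1 : ℤ) else 0) =
      ∑ d ∈ Finset.Icc 1 N,
        if d ∣ p.1 ∧ d ∣ p.2 then ArithmeticFunction.moebius d else 0 := by
    simp only [hP, Finset.mem_filter, Finset.mem_product, Finset.mem_Icc] at hp
    rw [← Finset.sum_filter]
    refine sum_divisors_moebius_eq_ite.symm.trans (Finset.sum_congr ?_ fun _ _ ↦ rfl)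
    ext d
    simp only [Nat.mem_divisors, Finset.mem_filter, Finset.mem_Icc, Nat.dvd_gcd_iff]
    have hg : Nat.gcd p.1 p.2 ≠ 0 := (Nat.gcd_pos_of_pos_left _ hp.1.1.1).ne'
    constructor
    · rintro ⟨h, -⟩
      exact ⟨⟨Nat.pos_of_dvd_of_pos h.1 hp.1.1.1, (Nat.le_of_dvd hp.1.1.1 h.1).trans hp.1.1.2⟩, h⟩
    · rintro ⟨-, h⟩
      exact ⟨h, hg⟩
  have hfilter : ((Finset.Icc 1 N ×ˢ Finset.Icc 1 N).filter fun p : ℕ × ℕ ↦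
      p.1.Coprime p.2 ∧ a.Coprime p.1 ∧ a.Coprime p.2) = P.filter fun p ↦ p.1.Coprime p.2 := by
    rw [hP, Finset.filter_filter]
    exact Finset.filter_congr fun _ _ ↦ and_comm
  rw [hfilter, Finset.card_filter]
  push_cast
  rw [Finset.sum_congr rfl hpair, Finset.sum_comm]
  refine Finset.sum_congr rfl fun d hd ↦ ?_
  have hprod : P.filter (fun p ↦ d ∣ p.1 ∧ d ∣ p.2) =
      ((Finset.Icc 1 N).filter fun n ↦ a.Coprime n ∧ d ∣ n) ×ˢ
        ((Finset.Icc 1 N).filter fun n ↦ a.Coprime n ∧ d ∣ n) := by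
    ext p
    simp only [hP, Finset.mem_filter, Finset.mem_product]
    tauto
  rw [← Finset.sum_filter, Finset.sum_const, hprod, Finset.card_product,
    card_filter_coprime_dvd a N d (Finset.mem_Icc.1 hd).1]
  split_ifs <;> simp [sq, mul_comm]

lemma card_pairs (a N : ℕ) :
    ((Finset.Icc 1 N ×ˢ Finset.Icc 1 N).filter fun p : ℕ × ℕ ↦
      a.Coprime p.1 ∧ a.Coprime p.2).card = coprimeCount a N ^ 2 := by
  rw [Finset.filter_product, Finset.card_product, sq, coprimeCount]

/-- The terms `μ(d) / d²`, restricted to the integers `d` coprime to `a`. -/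
noncomputable def moebiusCoprimeTerm (a d : ℕ) : ℝ :=
  if a.Coprime d then (ArithmeticFunction.moebius d : ℝ) / d ^ 2 else 0

lemma six_div_pi_sq_le_tsum_moebiusCoprimeTerm (a : ℕ) :
    6 / π ^ 2 ≤ ∑' d, moebiusCoprimeTerm a d := by
  let χ : DirichletCharacter ℂ a := 1
  let g : ℕ → ℝ := fun n ↦ if a.Coprime n then 1 / (n : ℝ) ^ 2 else 0
  have hχ (n : ℕ) : χ n = if a.Coprime n then 1 else 0 := by
    by_cases h : a.Coprime n
    · rw [if_pos h]
      exact MulChar.one_apply ((ZMod.isUnit_iff_coprime n a).2 h.symm)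
    · rw [if_neg h]
      exact χ.map_nonunit fun h' ↦ h ((ZMod.isUnit_iff_coprime n a).1 h').symm
  have hL : LSeries (fun n : ℕ ↦ χ n) 2 = ((∑' n, g n : ℝ) : ℂ) := by
    rw [LSeries, Complex.ofReal_tsum]
    refine tsum_congr fun n ↦ ?_
    rw [LSeries.term_of_ne_zero' two_ne_zero, hχ]
    simp only [g]
    split_ifs <;> simp
  have hM : LSeries ((fun n : ℕ ↦ χ n) * fun n : ℕ ↦ (ArithmeticFunction.moebius n : ℂ)) 2 =
      ((∑' n, moebiusCoprimeTerm a n : ℝ) : ℂ) := by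
    rw [LSeries, Complex.ofReal_tsum]
    refine tsum_congr fun n ↦ ?_
    rw [LSeries.term_of_ne_zero' two_ne_zero, Pi.mul_apply, hχ, moebiusCoprimeTerm]
    split_ifs <;> simp
  have hmul : (∑' n, g n) * ∑' n, moebiusCoprimeTerm a n = 1 := by
    have := DirichletCharacter.LSeries.mul_mu_eq_one χ (s := 2) (by norm_num)
    rw [hL, hM] at this
    exact_mod_cast this
  have hg0 (n : ℕ) : 0 ≤ g n := by
    simp only [g]
    split_ifs <;> positivity
  have hgle (n : ℕ) : g n ≤ 1 / (n : ℝ) ^ 2 := by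
    simp only [g]
    split_ifs
    · rfl
    · positivity
  have hle : ∑' n, g n ≤ π ^ 2 / 6 := by
    rw [← hasSum_zeta_two.tsum_eq]
    exact (hasSum_zeta_two.summable.of_nonneg_of_le hg0 hgle).tsum_le_tsum hgle
      hasSum_zeta_two.summable
  have hpos : 0 < ∑' n, g n :=
    (tsum_nonneg hg0).lt_of_ne fun h ↦ by simp [← h] at hmul
  rw [eq_one_div_of_mul_eq_one_right hmul, ← one_div_div]
  exact one_div_le_one_div_of_le hpos hle

lemma tendsto_card_coprime_pairs_div_sq {a : ℕ} (ha : 0 < a) :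
    Tendsto (fun N : ℕ ↦ (((Finset.Icc 1 N ×ˢ Finset.Icc 1 N).filter fun p : ℕ × ℕ ↦
        p.1.Coprime p.2 ∧ a.Coprime p.1 ∧ a.Coprime p.2).card : ℝ) / (N : ℝ) ^ 2) atTop
      (nhds ((a.totient / a : ℝ) ^ 2 * ∑' d, moebiusCoprimeTerm a d)) := by
  let f (N d : ℕ) : ℝ := if a.Coprime d then
    (ArithmeticFunction.moebius d : ℝ) * ((coprimeCount a (N / d) : ℝ) / N) ^ 2 else 0
  have hcard (N : ℕ) : (((Finset.Icc 1 N ×ˢ Finset.Icc 1 N).filter fun p : ℕ × ℕ ↦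
      p.1.Coprime p.2 ∧ a.Coprime p.1 ∧ a.Coprime p.2).card : ℝ) / (N : ℝ) ^ 2 =
        ∑' d, f N d := by
    rw [tsum_eq_sum (s := Finset.Icc 1 N), ← Int.cast_natCast, card_coprime_pairs, Int.cast_sum,
      Finset.sum_div]
    · refine Finset.sum_congr rfl fun d _ ↦ ?_
      simp only [f]
      split_ifs
      · push_cast
        ring
      · simp
    · intro d hd
      have : d = 0 ∨ N / d = 0 := by
        rw [Nat.div_eq_zero_iff]
        simp only [Finset.mem_Icc] at hd
        omega
      rcases this with rfl | h
      · simp [f]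
      · simp [f, h, coprimeCount]
  simp_rw [hcard, ← tsum_mul_left]
  refine tendsto_tsum_of_dominated_convergence hasSum_zeta_two.summable (fun d ↦ ?_)
    (.of_forall fun N d ↦ ?_)
  · simp only [f, moebiusCoprimeTerm]
    split_ifs
    · rcases Nat.eq_zero_or_pos d with rfl | hd
      · simp
      · convert ((tendsto_coprimeCount_div ha hd).pow 2).const_mul
          (ArithmeticFunction.moebius d : ℝ) using 2
        ring
    · simp
  · simp only [f]
    split_ifs
    · have hμ : |(ArithmeticFunction.moebius d : ℝ)| ≤ 1 := by
        exact_mod_cast ArithmeticFunction.abs_moebius_le_one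
      have hcount : (coprimeCount a (N / d) : ℝ) / N ≤ 1 / d := by
        refine div_le_of_le_mul₀ (Nat.cast_nonneg _) (by positivity) ?_
        calc (coprimeCount a (N / d) : ℝ) ≤ (N / d : ℕ) := by
              exact_mod_cast coprimeCount_le _ _
          _ ≤ N / d := Nat.cast_div_le
          _ = 1 / d * N := by ring
      rw [norm_mul, Real.norm_eq_abs, norm_pow, Real.norm_of_nonneg (by positivity),
        ← one_div_pow]
      exact (mul_le_of_le_one_left (by positivity) hμ).trans (by gcongr)
    · simp

open Filter Real

/-- Conditional density bound: among pairs `(n₁, n₂)` in `{1, …, N}²` with both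
entries coprime to `a`, the proportion that are also coprime to each other has
`liminf` at least `6/π²` as `N → ∞`. -/
theorem continuous_shor_conditional_coprime_density (a : ℕ) (ha : 0 < a) :
    6 / π ^ 2 ≤
      Filter.liminf
        (fun N : ℕ =>
          ((((Finset.Icc 1 N) ×ˢ (Finset.Icc 1 N)).filter
              (fun p : ℕ × ℕ =>
                Nat.gcd p.1 p.2 = 1 ∧ Nat.gcd a p.1 = 1 ∧ Nat.gcd a p.2 = 1)).card : ℝ) /
          ((((Finset.Icc 1 N) ×ˢ (Finset.Icc 1 N)).filter
              (fun p : ℕ × ℕ => Nat.gcd a p.1 = 1 ∧ Nat.gcd a p.2 = 1)).card : ℝ))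
        atTop := by

  have hpos : (0 : ℝ) < a.totient / a := by
    have := Nat.totient_pos.2 ha
    positivity
  have hD : Tendsto (fun N : ℕ ↦ ((coprimeCount a N : ℝ) / N) ^ 2) atTop
      (nhds ((a.totient / a : ℝ) ^ 2)) := by
    simpa using (tendsto_coprimeCount_div ha one_pos).pow 2
  have hlim := (tendsto_card_coprime_pairs_div_sq ha).div hD (by positivity)
  rw [mul_div_cancel_left₀ _ (by positivity)] at hlim
  refine (six_div_pi_sq_le_tsum_moebiusCoprimeTerm a).trans_eq
    (Tendsto.liminf_eq (hlim.congr' ?_)).symm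
  filter_upwards [eventually_gt_atTop 0] with N hN
  have hN' : (N : ℝ) ^ 2 ≠ 0 := by positivity
  have hcard : (((Finset.Icc 1 N ×ˢ Finset.Icc 1 N).filter fun p : ℕ × ℕ ↦
      Nat.gcd a p.1 = 1 ∧ Nat.gcd a p.2 = 1).card : ℝ) = (coprimeCount a N : ℝ) ^ 2 :=
    mod_cast card_pairs a N
  rw [hcard, Pi.div_apply, div_pow, div_div_div_cancel_right₀ hN']
end
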